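/- Every QU-res refutation of Φ_n and every QU-res refutation of Ω_n has superpolynomial size: for every polynomial q, for all sufficiently large n, every QU-res refutation of Φ_n has size greater than q(n), and every QU-res refutation of Ω_n has size greater than q(n). -/

import Mathlib

/-! ## Propositional / QBF side -/

inductive Lit where
  | pos (x : ℕ)
  | neg (x : ℕ)
deriving DecidableEq

def Lit.var : Lit → ℕ
  | pos x => x
  | neg x => x

def Lit.isPos : Lit → Bool
  | pos _ => true
  | neg _ => false

def Lit.negate : Lit → Lit
  | pos x => neg x
  | neg x => pos x

def Lit.eval (v : ℕ → Bool) : Lit → Bool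
  | pos x => v x
  | neg x => !(v x)

abbrev Clause := Finset Lit

def Clause.Taut (C : Clause) : Prop := ∃ x, Lit.pos x ∈ C ∧ Lit.neg x ∈ C

/-- A prenex CNF: a list of quantifier blocks (`true` = existential,
`false` = universal), each with an ordered list of variables, and a matrix
which is a finite set of clauses. -/
structure PCNF where
  blocks : List (Bool × List ℕ)
  matrix : Finset Clause

def PCNF.allVars (Φ : PCNF) : List ℕ := Φ.blocks.flatMap (·.2)

/-- Well-formedness: quantifier blocks alternate and the blocks are
pairwise disjoint sets of variables (no repetitions). -/
def PCNF.WF (Φ : PCNF) : Prop :=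
  List.Chain' (fun a b => a.1 ≠ b.1) Φ.blocks ∧ Φ.allVars.Nodup ∧
    ∀ b ∈ Φ.blocks, b.2 ≠ []

/-- Closedness: every variable of the matrix is quantified in the prefix. -/
def PCNF.Closed (Φ : PCNF) : Prop :=
  ∀ C ∈ Φ.matrix, ∀ l ∈ C, l.var ∈ Φ.allVars

def PCNF.existB (Φ : PCNF) (x : ℕ) : Bool :=
  Φ.blocks.any fun b => b.1 && b.2.contains x

def PCNF.univB (Φ : PCNF) (x : ℕ) : Bool :=
  Φ.blocks.any fun b => !b.1 && b.2.contains x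

/-- The level of a variable: the index of its quantifier block. -/
def PCNF.lv (Φ : PCNF) (x : ℕ) : ℕ :=
  Φ.blocks.findIdx fun b => b.2.contains x

def evalClause (v : ℕ → Bool) (C : Clause) : Prop := ∃ l ∈ C, l.eval v = true

/-- Standard QBF semantics of a prenex CNF, evaluated block by block. -/
def truthAux (M : Finset Clause) : List (Bool × List ℕ) → (ℕ → Bool) → Prop
  | [], v => ∀ C ∈ M, evalClause v C
  | (q, xs) :: rest, v =>
      if q then ∃ w : ℕ → Bool, (∀ y, y ∉ xs → w y = v y) ∧ truthAux M rest w
      else ∀ w : ℕ → Bool, (∀ y, y ∉ xs → w y = v y) → truthAux M rest w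

def PCNF.IsTrue (Φ : PCNF) : Prop := truthAux Φ.matrix Φ.blocks fun _ => false

/-! ## Q-resolution and QU-resolution -/

/-- One derivation step of Q-res (`univPivot = false`) resp. QU-res
(`univPivot = true`) from the clauses derived so far. -/
inductive QStep (Φ : PCNF) (univPivot : Bool) (prev : List Clause) : Clause → Prop
  | ax (C : Clause) (hC : C ∈ Φ.matrix) (hnt : ¬ C.Taut) : QStep Φ univPivot prev C
  | res (x : ℕ) (A B : Clause) (hA : A ∈ prev) (hB : B ∈ prev)
      (hxa : Lit.pos x ∈ A) (hxb : Lit.neg x ∈ B)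
      (hpiv : Φ.existB x = true ∨ (univPivot = true ∧ Φ.univB x = true))
      (hblock : ∀ l ∈ A.erase (Lit.pos x), l.negate ∉ B.erase (Lit.neg x)) :
      QStep Φ univPivot prev ((A.erase (Lit.pos x)) ∪ (B.erase (Lit.neg x)))
  | fac (A : Clause) (hA : A ∈ prev) : QStep Φ univPivot prev A
  | univRed (A : Clause) (m : Lit) (hA : A ∈ prev) (hm : m ∈ A)
      (hu : Φ.univB m.var = true)
      (hlv : ∀ l ∈ A.erase m, Φ.existB l.var = true → Φ.lv l.var < Φ.lv m.var) :
      QStep Φ univPivot prev (A.erase m)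

def QValid (Φ : PCNF) (univPivot : Bool) (π : List Clause) : Prop :=
  ∀ i < π.length, QStep Φ univPivot (π.take i) π[i]!

def QRefutation (Φ : PCNF) (univPivot : Bool) (π : List Clause) : Prop :=
  QValid Φ univPivot π ∧ π ≠ [] ∧ π.getLast! = (∅ : Clause)

/-- Size of a (QBF) resolution derivation: total number of literal
occurrences in its clauses. -/
def qSize (π : List Clause) : ℕ := (π.map Finset.card).sum

/-! ## First-order terms, atoms, literals, clauses -/

inductive FTerm where
  | var (x : ℕ)
  | app (f : ℕ) (args : List FTerm)

noncomputable instance : DecidableEq FTerm := Classical.decEq _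

def FTerm.subst (σ : ℕ → FTerm) : FTerm → FTerm
  | .var x => σ x
  | .app f args => .app f (args.attach.map fun t => t.1.subst σ)
decreasing_by
  have := List.sizeOf_lt_of_mem t.2
  simp only [FTerm.app.sizeOf_spec]; omega

def FTerm.symSize : FTerm → ℕ
  | .var _ => 1
  | .app _ args => 1 + (args.attach.map fun t => t.1.symSize).sum
decreasing_by
  have := List.sizeOf_lt_of_mem t.2
  simp only [FTerm.app.sizeOf_spec]; omega

def FTerm.vars : FTerm → Finset ℕ
  | .var x => {x}
  | .app _ args => (args.attach.map fun t => t.1.vars).foldr (· ∪ ·) ∅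
decreasing_by
  have := List.sizeOf_lt_of_mem t.2
  simp only [FTerm.app.sizeOf_spec]; omega

/-- An atom `p(t₁,…,t_k)`: predicate symbol together with argument list. -/
structure FAtom where
  p : ℕ
  args : List FTerm

noncomputable instance : DecidableEq FAtom := Classical.decEq _

def FAtom.subst (σ : ℕ → FTerm) (a : FAtom) : FAtom := ⟨a.p, a.args.map (FTerm.subst σ)⟩
def FAtom.symSize (a : FAtom) : ℕ := 1 + (a.args.map FTerm.symSize).sum
def FAtom.vars (a : FAtom) : Finset ℕ := (a.args.map FTerm.vars).foldr (· ∪ ·) ∅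

inductive FLit where
  | pos (a : FAtom)
  | neg (a : FAtom)

noncomputable instance : DecidableEq FLit := Classical.decEq _

def FLit.atom : FLit → FAtom
  | pos a => a
  | neg a => a

def FLit.isPos : FLit → Bool
  | pos _ => true
  | neg _ => false

def FLit.subst (σ : ℕ → FTerm) : FLit → FLit
  | pos a => pos (a.subst σ)
  | neg a => neg (a.subst σ)

def FLit.symSize (l : FLit) : ℕ :=
  match l with
  | .pos a => a.symSize
  | .neg a => 1 + a.symSize

abbrev FClause := Finset FLit

noncomputable def FClause.subst (σ : ℕ → FTerm) (C : FClause) : FClause :=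
  C.image (FLit.subst σ)

noncomputable def FClause.symSize (C : FClause) : ℕ := ∑ l ∈ C, l.symSize

noncomputable def FClause.fvars (C : FClause) : Finset ℕ := C.sup fun l => l.atom.vars

/-! ## First-order resolution R1 -/

def compSub (σ μ : ℕ → FTerm) : ℕ → FTerm := fun x => (σ x).subst μ

def Unifies (σ : ℕ → FTerm) (a b : FAtom) : Prop := a.subst σ = b.subst σ

def IsMGU (σ : ℕ → FTerm) (a b : FAtom) : Prop :=
  Unifies σ a b ∧ ∀ τ, Unifies τ a b → ∃ μ, ∀ x, compSub σ μ x = τ x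

/-- `D` is a factor of `C`: `D = Cσ` for `σ` an mgu of two distinct
same-sign literals of `C`. -/
def IsFactor (C D : FClause) : Prop :=
  ∃ K L σ, K ∈ C ∧ L ∈ C ∧ K ≠ L ∧ K.isPos = L.isPos ∧
    IsMGU σ K.atom L.atom ∧ D = C.subst σ

def renameSub (ρ : ℕ → ℕ) : ℕ → FTerm := fun x => .var (ρ x)

/-- `E` is a resolvent of `C` and `D`. -/
def IsResolvent (C D E : FClause) : Prop :=
  ∃ ρ : ℕ → ℕ, Function.Injective ρ ∧
    ∃ K L σ, Disjoint C.fvars (FClause.subst (renameSub ρ) D).fvars ∧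
      K ∈ C ∧ L ∈ FClause.subst (renameSub ρ) D ∧ K.isPos = !L.isPos ∧
      IsMGU σ K.atom L.atom ∧
      E = ((C.subst σ).erase (K.subst σ)) ∪
          (((FClause.subst (renameSub ρ) D).subst σ).erase (L.subst σ))

def R1Valid (S : Set FClause) (π : List FClause) : Prop :=
  ∀ i < π.length,
    π[i]! ∈ S ∨ (∃ j < i, IsFactor π[j]! π[i]!) ∨
      (∃ j < i, ∃ k < i, IsResolvent π[j]! π[k]! π[i]!)

def R1Refutation (S : Set FClause) (π : List FClause) : Prop :=
  R1Valid S π ∧ π ≠ [] ∧ π.getLast! = (∅ : FClause)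

noncomputable def r1Size (π : List FClause) : ℕ := (π.map FClause.symSize).sum

/-- Tree-form R1 refutations: every clause occurrence is used at most once
as a premise, which is inherent in a tree-structured derivation. -/
inductive R1Tree (S : Set FClause) : FClause → Type
  | input (C : FClause) (h : C ∈ S) : R1Tree S C
  | factor {C : FClause} (t : R1Tree S C) (D : FClause) (h : IsFactor C D) : R1Tree S D
  | resolve {C D : FClause} (t₁ : R1Tree S C) (t₂ : R1Tree S D) (E : FClause)
      (h : IsResolvent C D E) : R1Tree S E

noncomputable def R1Tree.size {S : Set FClause} : {C : FClause} → R1Tree S C → ℕ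
  | C, .input _ _ => C.symSize
  | D, .factor t _ _ => t.size + D.symSize
  | E, .resolve t₁ t₂ _ _ => t₁.size + t₂.size + E.symSize

def R1Tree.clauseCount {S : Set FClause} : {C : FClause} → R1Tree S C → ℕ
  | _, .input _ _ => 1
  | _, .factor t _ _ => t.clauseCount + 1
  | _, .resolve t₁ t₂ _ _ => t₁.clauseCount + t₂.clauseCount + 1

/-! ## The Skolem and EPR translations -/

/-- The universal variables strictly preceding `a` in the prefix,
in prefix order. -/
def PCNF.univBefore (Φ : PCNF) (a : ℕ) : List ℕ :=
  ((Φ.blocks.flatMap fun b => b.2.map fun x => (b.1, x)).takeWhile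
      fun p => p.2 ≠ a).filterMap
    fun p => if p.1 = false then some p.2 else none

/-- `p` is the predicate symbol `0`; `f₀`, `f₁` are the constants `0`, `1`;
the Skolem function symbol for existential variable `a` is `a + 2`. -/
def skAtom (Φ : PCNF) (x : ℕ) : FAtom :=
  if Φ.existB x then ⟨0, [FTerm.app (x + 2) ((Φ.univBefore x).map FTerm.var)]⟩
  else ⟨0, [FTerm.var x]⟩

def skLit (Φ : PCNF) : Lit → FLit
  | .pos x => .pos (skAtom Φ x)
  | .neg x => .neg (skAtom Φ x)

noncomputable def skClause (Φ : PCNF) (C : Clause) : FClause := C.image (skLit Φ)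

def pf1Cl : FClause := {FLit.pos ⟨0, [FTerm.app 1 []]⟩}
def npf0Cl : FClause := {FLit.neg ⟨0, [FTerm.app 0 []]⟩}

/-- The clause set `Sk(Φ) ∪ {p(f₁), ¬p(f₀)}`. -/
noncomputable def skSet (Φ : PCNF) : Set FClause :=
  ↑(Φ.matrix.image (skClause Φ)) ∪ {pf1Cl, npf0Cl}

/-- EPR atom: `p(f_a(u₁,…,u_k))` with `k ≥ 1` becomes `p_a(u₁,…,u_k)`,
where the fresh predicate symbol `p_a` is `a + 1`. -/
def eprAtom (Φ : PCNF) (x : ℕ) : FAtom :=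
  if Φ.existB x then
    if Φ.univBefore x = [] then ⟨0, [FTerm.app (x + 2) []]⟩
    else ⟨x + 1, (Φ.univBefore x).map FTerm.var⟩
  else ⟨0, [FTerm.var x]⟩

def eprLit (Φ : PCNF) : Lit → FLit
  | .pos x => .pos (eprAtom Φ x)
  | .neg x => .neg (eprAtom Φ x)

noncomputable def eprClause (Φ : PCNF) (C : Clause) : FClause := C.image (eprLit Φ)

/-- The clause set `EPR(Φ) ∪ {p(f₁), ¬p(f₀)}`. -/
noncomputable def eprSet (Φ : PCNF) : Set FClause :=
  ↑(Φ.matrix.image (eprClause Φ)) ∪ {pf1Cl, npf0Cl}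

/-! ## IR-calc and its extensions -/

/-- An annotation: a (functional) finite set of assignments
`universal variable ↦ 0/1` (`false` = 0, `true` = 1). -/
abbrev Ann := Finset (ℕ × Bool)

def Ann.Functional (τ : Ann) : Prop := ∀ x b b', (x, b) ∈ τ → (x, b') ∈ τ → b = b'

/-- Restriction `[σ]` of an annotation to the universal variables of level
below the level of the literal `l`. -/
def annRestr (Φ : PCNF) (σ : Ann) (l : Lit) : Ann :=
  σ.filter fun p => Φ.lv p.1 < Φ.lv l.var

/-- Completion of `μ` by `τ`. -/
def annCompl (μ τ : Ann) : Ann :=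
  μ ∪ τ.filter fun p => p.1 ∉ μ.image Prod.fst

structure ALit where
  lit : Lit
  ann : Ann
deriving DecidableEq

abbrev AClause := Finset ALit

def ALit.symSize (al : ALit) : ℕ := 1 + 2 * al.ann.card
def AClause.symSize (A : AClause) : ℕ := ∑ al ∈ A, al.symSize
def aSize (π : List AClause) : ℕ := (π.map AClause.symSize).sum

/-- The annotation extracted from the universal literals of a clause:
`u ↦ 0` for positive and `u ↦ 1` for negative universal literals. -/
def axAnn (Φ : PCNF) (C : Clause) : Ann :=
  (C.filter fun l => Φ.univB l.var).image fun l =>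
    match l with
    | .pos u => (u, false)
    | .neg u => (u, true)

/-- The axiom clause of IR-calc obtained from a matrix clause. -/
def axClause (Φ : PCNF) (C : Clause) : AClause :=
  (C.filter fun l => Φ.existB l.var).image fun l => ⟨l, annRestr Φ (axAnn Φ C) l⟩

/-- Application of a variable substitution `σ_v` (universal ↦ existential)
to a literal. -/
def applySigv (σv : ℕ → Option ℕ) : Lit → Lit
  | .pos x => match σv x with | some e => .pos e | none => .pos x
  | .neg x => match σv x with | some e => .neg e | none => .neg x

def Clause.applySigv (σv : ℕ → Option ℕ) (C : Clause) : Clause :=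
  C.image (_root_.applySigv σv)

/-- Admissibility of `σ_v`: it maps universal variables to existential
variables of strictly smaller level. -/
def Admissible (Φ : PCNF) (σv : ℕ → Option ℕ) : Prop :=
  ∀ x e, σv x = some e → Φ.univB x = true ∧ Φ.existB e = true ∧ Φ.lv e < Φ.lv x

/-- One step of IR-calc(P, M, Δ, σ_v).  Plain IR-calc is the instance with
`Δ = ∅` and `σv = fun _ => none`; IR-calc^{σ_v} the instance with `Δ = ∅`. -/
inductive IRStep (Φ : PCNF) (Δ : Finset Clause) (σv : ℕ → Option ℕ)
    (prev : List AClause) : AClause → Prop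
  | ax (C : Clause) (hC : C ∈ Φ.matrix) (hnt : ¬ C.Taut)
      (hnt' : ¬ (C.applySigv σv).Taut) :
      IRStep Φ Δ σv prev (axClause Φ (C.applySigv σv))
  | axExt (C : Clause) (hC : C ∈ Δ) (hnt : ¬ C.Taut) :
      IRStep Φ Δ σv prev (C.image fun l => ⟨l, ∅⟩)
  | res (x : ℕ) (τ : Ann) (A B : AClause) (hA : A ∈ prev) (hB : B ∈ prev)
      (hxa : (⟨Lit.pos x, τ⟩ : ALit) ∈ A) (hxb : (⟨Lit.neg x, τ⟩ : ALit) ∈ B) :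
      IRStep Φ Δ σv prev ((A.erase ⟨Lit.pos x, τ⟩) ∪ (B.erase ⟨Lit.neg x, τ⟩))
  | fac (A : AClause) (hA : A ∈ prev) : IRStep Φ Δ σv prev A
  | inst (A : AClause) (τ : Ann) (hA : A ∈ prev) (hfun : τ.Functional)
      (hdom : ∀ p ∈ τ, Φ.univB p.1 = true) :
      IRStep Φ Δ σv prev
        (A.image fun al => ⟨al.lit, annRestr Φ (annCompl al.ann τ) al.lit⟩)

def IRValid (Φ : PCNF) (Δ : Finset Clause) (σv : ℕ → Option ℕ)
    (π : List AClause) : Prop :=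
  ∀ i < π.length, IRStep Φ Δ σv (π.take i) π[i]!

def IRRefutation (Φ : PCNF) (Δ : Finset Clause) (σv : ℕ → Option ℕ)
    (π : List AClause) : Prop :=
  IRValid Φ Δ σv π ∧ π ≠ [] ∧ π.getLast! = (∅ : AClause)

def noSub : ℕ → Option ℕ := fun _ => none

/-- Tree-form IR-calc(P, M, Δ, σ_v) derivations. -/
inductive IRTree (Φ : PCNF) (Δ : Finset Clause) (σv : ℕ → Option ℕ) : AClause → Type
  | ax (C : Clause) (hC : C ∈ Φ.matrix) (hnt : ¬ C.Taut)
      (hnt' : ¬ (C.applySigv σv).Taut) : IRTree Φ Δ σv (axClause Φ (C.applySigv σv))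
  | axExt (C : Clause) (hC : C ∈ Δ) (hnt : ¬ C.Taut) :
      IRTree Φ Δ σv (C.image fun l => ⟨l, ∅⟩)
  | res {A B : AClause} (t₁ : IRTree Φ Δ σv A) (t₂ : IRTree Φ Δ σv B)
      (x : ℕ) (τ : Ann)
      (hxa : (⟨Lit.pos x, τ⟩ : ALit) ∈ A) (hxb : (⟨Lit.neg x, τ⟩ : ALit) ∈ B) :
      IRTree Φ Δ σv ((A.erase ⟨Lit.pos x, τ⟩) ∪ (B.erase ⟨Lit.neg x, τ⟩))
  | inst {A : AClause} (t : IRTree Φ Δ σv A) (τ : Ann) (hfun : τ.Functional)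
      (hdom : ∀ p ∈ τ, Φ.univB p.1 = true) :
      IRTree Φ Δ σv (A.image fun al => ⟨al.lit, annRestr Φ (annCompl al.ann τ) al.lit⟩)

def IRTree.size {Φ : PCNF} {Δ : Finset Clause} {σv : ℕ → Option ℕ} :
    {A : AClause} → IRTree Φ Δ σv A → ℕ
  | _, .ax C _ _ _ => AClause.symSize (axClause Φ (C.applySigv σv))
  | _, .axExt C _ _ => AClause.symSize (C.image fun l => (⟨l, ∅⟩ : ALit))
  | _, .res (A := A) (B := B) t₁ t₂ x τ _ _ =>
      t₁.size + t₂.size +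
        AClause.symSize ((A.erase ⟨Lit.pos x, τ⟩) ∪ (B.erase ⟨Lit.neg x, τ⟩))
  | _, .inst (A := A) t τ _ _ =>
      t.size + AClause.symSize (A.image fun al =>
        (⟨al.lit, annRestr Φ (annCompl al.ann τ) al.lit⟩ : ALit))

/-! ## The formula families Φ_n and Ω_n (pigeonhole based) -/

def xv (i j : ℕ) : ℕ := Nat.pair 0 (Nat.pair i (Nat.pair j 0))
def yv (i j : ℕ) : ℕ := Nat.pair 1 (Nat.pair i (Nat.pair j 0))
def zv (i₁ i₂ j : ℕ) : ℕ := Nat.pair 2 (Nat.pair i₁ (Nat.pair i₂ j))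

def Xlist (n : ℕ) : List ℕ :=
  (List.range (n+1)).flatMap fun i => (List.range n).map fun j => xv (i+1) (j+1)
def Ylist (n : ℕ) : List ℕ :=
  (List.range (n+1)).flatMap fun i => (List.range n).map fun j => yv (i+1) (j+1)
def Zlist (n : ℕ) : List ℕ :=
  ((List.range (n+1)).map fun i => zv (i+1) 0 0) ++
  ((List.range n).flatMap fun j => (List.range (n+1)).flatMap fun i₁ =>
    (List.range (n+1)).filterMap fun i₂ =>
      if i₁ < i₂ then some (zv (i₁+1) (i₂+1) (j+1)) else none)

/-- The clauses of PHP_n(X_n). -/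
def PHPcls (n : ℕ) : Finset Clause :=
  ((List.range (n+1)).map fun i =>
      (((List.range n).map fun j => Lit.pos (xv (i+1) (j+1))).toFinset : Clause)).toFinset ∪
  ((List.range n).flatMap fun j => (List.range (n+1)).flatMap fun i₁ =>
    (List.range (n+1)).filterMap fun i₂ =>
      if i₁ < i₂ then
        some ({Lit.neg (xv (i₁+1) (j+1)), Lit.neg (xv (i₂+1) (j+1))} : Clause)
      else none).toFinset

/-- The clauses of TPHP′_n(Y_n, Z_n). -/
def TPHPcls (n : ℕ) : Finset Clause :=
  {(((Zlist n).map Lit.neg).toFinset : Clause)} ∪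
  ((List.range (n+1)).flatMap fun i => (List.range n).map fun j =>
      ({Lit.pos (zv (i+1) 0 0), Lit.neg (yv (i+1) (j+1))} : Clause)).toFinset ∪
  ((List.range n).flatMap fun j => (List.range (n+1)).flatMap fun i₁ =>
    (List.range (n+1)).flatMap fun i₂ =>
      if i₁ < i₂ then
        [({Lit.pos (zv (i₁+1) (i₂+1) (j+1)), Lit.pos (yv (i₁+1) (j+1))} : Clause),
         ({Lit.pos (zv (i₁+1) (i₂+1) (j+1)), Lit.pos (yv (i₂+1) (j+1))} : Clause)]
      else []).toFinset

def phiMatrix (n : ℕ) : Finset Clause := TPHPcls n ∪ PHPcls n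

/-- Φ_n = ∃X_n ∀Y_n ∃Z_n (TPHP′_n ∧ PHP_n). -/
def PhiF (n : ℕ) : PCNF :=
  ⟨[(true, Xlist n), (false, Ylist n), (true, Zlist n)], phiMatrix n⟩

/-- Ω_n = ∀Y_n ∃Z_n ∃X_n (TPHP′_n ∧ PHP_n) (Z_n and X_n form one block). -/
def OmegaF (n : ℕ) : PCNF :=
  ⟨[(false, Ylist n), (true, Zlist n ++ Xlist n)], phiMatrix n⟩

/-! ## The formula family Ψ_t of Kleine Büning, Karpinski and Flögel -/

def dv (j : ℕ) : ℕ := 5*j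
def ev (j : ℕ) : ℕ := 5*j+1
def xvv (j : ℕ) : ℕ := 5*j+2
def fv (j : ℕ) : ℕ := 5*j+3
def qv (j : ℕ) : ℕ := 5*j+4

/-- The prefix P_t; if `withQ` is set, the fresh extension variable `q_i`
is placed in the same existential block as `d_i` and `e_i`. -/
def psiPrefix (t : ℕ) (withQ : Bool) : List (Bool × List ℕ) :=
  ((true, [dv 0, dv 1, ev 1] ++ if withQ then [qv 1] else []) ::
    (List.range (t-1)).flatMap fun j =>
      [(false, [xvv (j+1)]),
       (true, [dv (j+2), ev (j+2)] ++ if withQ then [qv (j+2)] else [])]) ++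
  [(false, [xvv t]), (true, (List.range t).map fun i => fv (i+1))]

def fNegs (t : ℕ) : List Lit := (List.range t).map fun i => Lit.neg (fv (i+1))

def psiMatrix (t : ℕ) : Finset Clause :=
  ({({Lit.neg (dv 0)} : Clause),
    ({Lit.pos (dv 0), Lit.neg (dv 1), Lit.neg (ev 1)} : Clause),
    (((Lit.pos (dv t) :: Lit.neg (xvv t) :: fNegs t).toFinset : Clause)),
    (((Lit.pos (ev t) :: Lit.pos (xvv t) :: fNegs t).toFinset : Clause))} : Finset Clause) ∪
  ((List.range (t-1)).flatMap fun j =>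
     [({Lit.pos (dv (j+1)), Lit.neg (xvv (j+1)), Lit.neg (dv (j+2)), Lit.neg (ev (j+2))} : Clause),
      ({Lit.pos (ev (j+1)), Lit.pos (xvv (j+1)), Lit.neg (dv (j+2)), Lit.neg (ev (j+2))} : Clause)]).toFinset ∪
  ((List.range t).flatMap fun j =>
     [({Lit.neg (xvv (j+1)), Lit.pos (fv (j+1))} : Clause),
      ({Lit.pos (xvv (j+1)), Lit.pos (fv (j+1))} : Clause)]).toFinset

def PsiF (t : ℕ) : PCNF := ⟨psiPrefix t false, psiMatrix t⟩

/-- Ψ_t with the extension variables q_i added to the prefix. -/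
def PsiFq (t : ℕ) : PCNF := ⟨psiPrefix t true, psiMatrix t⟩

/-- The extension clauses Δ: clausal form of q_i ↔ (¬d_i ∧ e_i), 1 ≤ i ≤ t. -/
def DeltaT (t : ℕ) : Finset Clause :=
  ((List.range t).flatMap fun i =>
    [({Lit.pos (qv (i+1)), Lit.pos (dv (i+1)), Lit.neg (ev (i+1))} : Clause),
     ({Lit.neg (qv (i+1)), Lit.neg (dv (i+1))} : Clause),
     ({Lit.neg (qv (i+1)), Lit.pos (ev (i+1))} : Clause)]).toFinset

/-- σ_{v,t} = { x_i ↦ q_i : 1 ≤ i ≤ t }. -/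
def sigmaQv (t : ℕ) : ℕ → Option ℕ := fun v =>
  if v % 5 = 2 ∧ 1 ≤ v / 5 ∧ v / 5 ≤ t then some (5 * (v / 5) + 4) else none

/-- σ_{v,t} = { x_i ↦ e_i : 1 ≤ i ≤ t }. -/
def sigmaEv (t : ℕ) : ℕ → Option ℕ := fun v =>
  if v % 5 = 2 ∧ 1 ≤ v / 5 ∧ v / 5 ≤ t then some (5 * (v / 5) + 1) else none

/-! ## Haken's lower bound, monotone form over critical assignments -/

section Haken
open Finset

variable {n : ℕ}

/-- A monotone clause is true under the critical assignment `g` (hole `j` holds pigeon `g j`). -/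
def MTrue (g : Fin n → Fin (n+1)) (M : Finset (Fin (n+1) × Fin n)) : Prop :=
  ∃ j, (g j, j) ∈ M

open Classical in
/-- The pigeons `i` for which some `i`-critical assignment extending `(g₀,R)` falsifies `M`. -/
noncomputable def Crit (g₀ : Fin n → Fin (n+1)) (R : Finset (Fin n))
    (M : Finset (Fin (n+1) × Fin n)) : Finset (Fin (n+1)) :=
  univ.filter fun i => ∃ g : Fin n → Fin (n+1), Function.Injective g ∧ (∀ j ∈ R, g j = g₀ j) ∧
    (∀ j, g j ≠ i) ∧ ¬ MTrue g M

/-- The part of `M` not touched by the restriction. -/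
def Rest (g₀ : Fin n → Fin (n+1)) (R : Finset (Fin n))
    (M : Finset (Fin (n+1) × Fin n)) : Finset (Fin (n+1) × Fin n) :=
  M.filter fun p => p.1 ∉ R.image g₀ ∧ p.2 ∉ R

/-- Large clauses surviving the restriction. -/
def LargeSet (K : ℕ) (g₀ : Fin n → Fin (n+1)) (R : Finset (Fin n))
    (F : Finset (Finset (Fin (n+1) × Fin n))) : Finset (Finset (Fin (n+1) × Fin n)) :=
  F.filter fun M => (∀ j ∈ R, (g₀ j, j) ∉ M) ∧ K ≤ (Rest g₀ R M).card

lemma exists_missing (g : Fin n → Fin (n+1)) : ∃ i, ∀ j, g j ≠ i := by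
  by_contra! h
  have := Fintype.card_le_of_surjective g h
  simp at this

lemma missing_unique (g : Fin n → Fin (n+1)) (hg : Function.Injective g) (i i' : Fin (n+1))
    (hi : ∀ j, g j ≠ i) (hne : i' ≠ i) : ∃ j, g j = i' := by
  by_contra! h
  have h1 : univ.image g ⊆ (univ.erase i).erase i' := by
    intro a ha
    simp only [mem_image, mem_univ, true_and] at ha
    obtain ⟨j, rfl⟩ := ha
    simp [hi j, h j]
  have h2 := card_le_card h1
  rw [card_image_of_injective _ hg, card_erase_of_mem (by simp [hne]),
    card_erase_of_mem (mem_univ _)] at h2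
  simp at h2
  have := i'.2
  have : n ≠ 0 := by
    rintro rfl
    exact hne (Fin.ext (by omega))
  omega

lemma update_inj (g : Fin n → Fin (n+1)) (hg : Function.Injective g) (i : Fin (n+1))
    (hi : ∀ j, g j ≠ i) (j : Fin n) : Function.Injective (Function.update g j i) := by
  intro a b hab
  rw [Function.update_apply, Function.update_apply] at hab
  split_ifs at hab with ha hb hb
  · rw [ha, hb]
  · exact absurd hab.symm (hi b)
  · exact absurd hab (hi a)
  · exact hg hab

lemma extend_pair (g : Fin n → Fin (n+1)) (hg : Function.Injective g) (R : Finset (Fin n))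
    (i : Fin (n+1)) (j : Fin n) (hj : j ∉ R) (hi : i ∉ R.image g) :
    ∃ g' : Fin n → Fin (n+1), Function.Injective g' ∧ (∀ k ∈ R, g' k = g k) ∧ g' j = i := by
  by_cases h : ∃ j', g j' = i
  · obtain ⟨j', rfl⟩ := h
    have hj' : j' ∉ R := fun h => hi (mem_image_of_mem _ h)
    refine ⟨g ∘ Equiv.swap j j', hg.comp (Equiv.injective _), ?_, by simp⟩
    intro k hk
    have h1 : k ≠ j := by rintro rfl; exact hj hk
    have h2 : k ≠ j' := by rintro rfl; exact hj' hk
    simp [Equiv.swap_apply_of_ne_of_ne h1 h2]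
  · push Not at h
    refine ⟨Function.update g j i, update_inj g hg i h j, ?_, by simp⟩
    intro k hk
    have h1 : k ≠ j := by rintro rfl; exact hj hk
    simp [h1]

lemma crit_subset (g₀ : Fin n → Fin (n+1)) (R : Finset (Fin n))
    (M : Finset (Fin (n+1) × Fin n)) : Crit g₀ R M ⊆ univ \ R.image g₀ := by
  intro i hi
  simp only [Crit, mem_filter, mem_univ, true_and] at hi
  obtain ⟨g, -, hR, hm, -⟩ := hi
  simp only [mem_sdiff, mem_univ, true_and, mem_image, not_exists, not_and]
  intro j hj h
  exact hm j (by rw [hR j hj, h])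

lemma card_free (g₀ : Fin n → Fin (n+1)) (hg : Function.Injective g₀) (R : Finset (Fin n)) :
    (univ \ R.image g₀).card = n + 1 - R.card := by
  rw [card_sdiff_of_subset (subset_univ _), card_image_of_injective _ hg]
  simp

lemma crit_empty (g₀ : Fin n → Fin (n+1)) (hg : Function.Injective g₀) (R : Finset (Fin n)) :
    n + 1 - R.card ≤ (Crit g₀ R ∅).card := by
  rw [← card_free g₀ hg R]
  apply card_le_card
  intro i hi
  simp only [mem_sdiff, mem_univ, true_and, mem_image, not_exists, not_and] at hi
  simp only [Crit, mem_filter, mem_univ, true_and]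
  by_cases h : ∃ j, g₀ j = i
  · obtain ⟨j, rfl⟩ := h
    obtain ⟨i0, hi0⟩ := exists_missing g₀
    refine ⟨Function.update g₀ j i0, update_inj g₀ hg i0 hi0 j, ?_, ?_, by simp [MTrue]⟩
    · intro k hk
      have : k ≠ j := by rintro rfl; exact hi k hk rfl
      simp [this]
    · intro k
      by_cases hk : k = j
      · subst hk; simpa using (hi0 k).symm
      · simpa [hk] using fun h => hk (hg h)
  · push Not at h
    exact ⟨g₀, hg, fun _ _ => rfl, h, by simp [MTrue]⟩

lemma wide (g₀ : Fin n → Fin (n+1)) (hg₀ : Function.Injective g₀) (R : Finset (Fin n))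
    (M : Finset (Fin (n+1) × Fin n)) :
    (Crit g₀ R M).card * (n + 1 - R.card - (Crit g₀ R M).card) ≤ (Rest g₀ R M).card := by
  classical
  set S := Crit g₀ R M with hS
  have hrow : ∀ i ∈ S, n + 1 - R.card - S.card ≤ ((Rest g₀ R M).filter fun p => p.1 = i).card := by
    intro i hi
    have hiP := crit_subset g₀ R M hi
    have hi' := hi
    simp only [hS, Crit, mem_filter, mem_univ, true_and] at hi'
    obtain ⟨g, hg, hR, hm, hf⟩ := hi'
    rw [← card_free g₀ hg₀ R, ← card_sdiff_of_subset (crit_subset g₀ R M)]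
    refine le_trans (card_le_card (t := ((Rest g₀ R M).filter fun p => p.1 = i).image
      fun p => g p.2) ?_) card_image_le
    intro i' h'
    rw [mem_sdiff] at h'
    obtain ⟨hP', hS'⟩ := h'
    have hne : i' ≠ i := by rintro rfl; exact hS' hi
    obtain ⟨j, hj⟩ := missing_unique g hg i i' hm hne
    have hjR : j ∉ R := by
      intro h
      simp only [mem_sdiff, mem_univ, true_and, mem_image, not_exists, not_and] at hP'
      exact hP' j h (by rw [← hR j h, hj])
    have hT : MTrue (Function.update g j i) M := by
      by_contra hF
      apply hS'
      simp only [hS, Crit, mem_filter, mem_univ, true_and]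
      refine ⟨_, update_inj g hg i hm j, ?_, ?_, hF⟩
      · intro k hk
        have : k ≠ j := by rintro rfl; exact hjR hk
        simp [this, hR k hk]
      · intro k
        by_cases hk : k = j
        · subst hk; simpa using hne.symm
        · simp only [ne_eq, hk, not_false_eq_true, Function.update_of_ne]
          rw [← hj]
          exact fun h => hk (hg h)
    obtain ⟨b, hb⟩ := hT
    have hbj : b = j := by
      by_contra hne
      simp only [ne_eq, hne, not_false_eq_true, Function.update_of_ne] at hb
      exact hf ⟨b, hb⟩
    subst hbj
    simp only [Function.update_self] at hb
    rw [mem_image]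
    refine ⟨(i, b), ?_, hj⟩
    simp only [mem_filter, Rest]
    refine ⟨⟨hb, ?_, hjR⟩, trivial⟩
    simpa using hiP
  calc S.card * (n + 1 - R.card - S.card) = ∑ i ∈ S, (n + 1 - R.card - S.card) := by simp
    _ ≤ ∑ i ∈ S, ((Rest g₀ R M).filter fun p => p.1 = i).card := sum_le_sum hrow
    _ = ((Rest g₀ R M).filter fun p => p.1 ∈ S).card := by
        rw [card_eq_sum_card_fiberwise (f := Prod.fst) (t := S)
          (by intro p hp; exact (mem_filter.1 hp).2)]
        apply sum_congr rfl
        intro i hi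
        congr 1
        ext p
        simp only [mem_filter]
        constructor
        · rintro ⟨h1, rfl⟩; exact ⟨⟨h1, hi⟩, rfl⟩
        · rintro ⟨⟨h1, _⟩, h2⟩; exact ⟨h1, h2⟩
    _ ≤ _ := card_le_card (filter_subset _ _)

/-- A clause with medium critical set is large and unkilled. -/
lemma medium_large (g₀ : Fin n → Fin (n+1)) (hg₀ : Function.Injective g₀) (R : Finset (Fin n))
    (m t : ℕ) (hRm : R.card ≤ m)
    (F : Finset (Finset (Fin (n+1) × Fin n))) (M : Finset (Fin (n+1) × Fin n)) (hM : M ∈ F)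
    (h1 : t < (Crit g₀ R M).card) (h2 : (Crit g₀ R M).card ≤ 2 * t) :
    M ∈ LargeSet ((t+1) * (n + 1 - m - 2 * t)) g₀ R F := by
  simp only [LargeSet, mem_filter]
  refine ⟨hM, ?_, le_trans (Nat.mul_le_mul h1 (by omega)) (wide g₀ hg₀ R M)⟩
  have : (Crit g₀ R M).Nonempty := by
    rw [← card_pos]; omega
  obtain ⟨i, hi⟩ := this
  simp only [Crit, mem_filter, mem_univ, true_and] at hi
  obtain ⟨g, hg, hR, hm, hf⟩ := hi
  intro j hj hjM
  exact hf ⟨j, by rwa [hR j hj]⟩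

lemma crit_res (g₀ : Fin n → Fin (n+1)) (R : Finset (Fin n))
    (A B M : Finset (Fin (n+1) × Fin n))
    (h : ∀ g, MTrue g A → MTrue g B → MTrue g M) :
    (Crit g₀ R M).card ≤ (Crit g₀ R A).card + (Crit g₀ R B).card := by
  classical
  refine le_trans (card_le_card ?_) (card_union_le _ _)
  intro i hi
  simp only [Crit, mem_filter, mem_univ, true_and, mem_union] at hi ⊢
  obtain ⟨g, hg, hR, hm, hf⟩ := hi
  by_cases hA : MTrue g A
  · exact Or.inr ⟨g, hg, hR, hm, fun hB => hf (h g hA hB)⟩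
  · exact Or.inl ⟨g, hg, hR, hm, hA⟩

lemma crit_ax (g₀ : Fin n → Fin (n+1)) (R : Finset (Fin n))
    (M : Finset (Fin (n+1) × Fin n)) (i : Fin (n+1))
    (h : ∀ g : Fin n → Fin (n+1), Function.Injective g → (∃ j, g j = i) → MTrue g M) :
    (Crit g₀ R M).card ≤ 1 := by
  refine le_trans (card_le_card (t := {i}) ?_) (by simp)
  intro k hk
  simp only [Crit, mem_filter, mem_univ, true_and] at hk
  obtain ⟨g, hg, hR, hm, hf⟩ := hk
  rw [mem_singleton]
  by_contra hne
  exact hf (h g hg (missing_unique g hg k i hm (Ne.symm hne)))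

lemma one_step (K : ℕ) (hK : n * (n+1) ≤ 32 * K)
    (g₀ : Fin n → Fin (n+1)) (hg₀ : Function.Injective g₀) (R : Finset (Fin n))
    (F : Finset (Finset (Fin (n+1) × Fin n))) (hne : (LargeSet K g₀ R F).Nonempty) (hK0 : 0 < K) :
    ∃ (g' : Fin n → Fin (n+1)) (R' : Finset (Fin n)), Function.Injective g' ∧
      R'.card ≤ R.card + 1 ∧ 32 * (LargeSet K g' R' F).card ≤ 31 * (LargeSet K g₀ R F).card := by
  classical
  set L := LargeSet K g₀ R F with hL
  set T : Finset (Fin (n+1) × Fin n) := Rest g₀ R univ with hT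
  have hTcard : T.card ≤ n * (n+1) := by
    refine le_trans (card_le_univ _) ?_
    simp [mul_comm]
  have hLpos : 0 < L.card := card_pos.2 hne
  have key : ∃ p ∈ T, L.card ≤ 32 * (L.filter fun M => p ∈ M).card := by
    by_contra! hcon
    have hdc : ∑ M ∈ L, (T.filter fun p => p ∈ M).card = ∑ p ∈ T, (L.filter fun M => p ∈ M).card := by
      simp only [card_filter]
      exact sum_comm
    have hlow : L.card * K ≤ ∑ M ∈ L, (T.filter fun p => p ∈ M).card := by
      rw [← smul_eq_mul]
      apply card_nsmul_le_sum
      intro M hM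
      simp only [hL, LargeSet, mem_filter] at hM
      refine le_trans hM.2.2 (card_le_card ?_)
      intro p hp
      simp only [Rest, mem_filter, hT, mem_univ, true_and] at hp ⊢
      exact ⟨hp.2, hp.1⟩
    have hTne : T.Nonempty := by
      by_contra hemp
      rw [not_nonempty_iff_eq_empty] at hemp
      rw [hdc, hemp, sum_empty] at hlow
      have : 0 < L.card * K := Nat.mul_pos hLpos hK0
      omega
    have hup : ∑ p ∈ T, 32 * (L.filter fun M => p ∈ M).card < ∑ p ∈ T, L.card :=
      sum_lt_sum_of_nonempty hTne hcon
    rw [← mul_sum, sum_const, smul_eq_mul, ← hdc] at hup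
    have : T.card * L.card ≤ 32 * K * L.card := Nat.mul_le_mul_right _ (hTcard.trans hK)
    nlinarith
  obtain ⟨⟨i, j⟩, hp, hcount⟩ := key
  simp only [hT, Rest, mem_filter, mem_univ, true_and] at hp
  obtain ⟨g', hg', hR', hj'⟩ := extend_pair g₀ hg₀ R i j hp.2 hp.1
  refine ⟨g', insert j R, hg', card_insert_le _ _, ?_⟩
  have hsub : LargeSet K g' (insert j R) F ⊆ L.filter fun M => ¬ (i, j) ∈ M := by
    intro M hM
    simp only [hL, LargeSet, mem_filter] at hM ⊢
    obtain ⟨hF, hk, hc⟩ := hM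
    refine ⟨⟨hF, ?_, hc.trans (card_le_card ?_)⟩, ?_⟩
    · intro k hkR
      rw [← hR' k hkR]
      exact hk k (mem_insert_of_mem hkR)
    · intro p hp
      simp only [Rest, mem_filter, mem_image, not_exists, not_and, mem_insert, not_or] at hp ⊢
      refine ⟨hp.1, ?_, hp.2.2.2⟩
      intro k hkR
      rw [← hR' k hkR]
      exact hp.2.1 k (Or.inr hkR)
    · rw [← hj']
      exact hk j (mem_insert_self _ _)
  have h1 := card_le_card hsub
  have h2 := card_filter_add_card_filter_not (s := L) (fun M => (i, j) ∈ M)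
  omega

lemma restrict_all (K : ℕ) (hK : n * (n+1) ≤ 32 * K) (hK0 : 0 < K)
    (F : Finset (Finset (Fin (n+1) × Fin n))) (m : ℕ) :
    ∃ (g' : Fin n → Fin (n+1)) (R' : Finset (Fin n)), Function.Injective g' ∧
      R'.card ≤ m ∧
      32 ^ m * (LargeSet K g' R' F).card ≤ 31 ^ m * (LargeSet K Fin.castSucc ∅ F).card := by
  induction m with
  | zero => exact ⟨Fin.castSucc, ∅, Fin.castSucc_injective n, by simp, by simp⟩
  | succ m ih =>
    obtain ⟨g, R, hg, hR, hc⟩ := ih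
    rcases (LargeSet K g R F).eq_empty_or_nonempty with he | hne
    · refine ⟨g, R, hg, by omega, ?_⟩
      rw [he]; simp
    · obtain ⟨g', R', hg', hR', hc'⟩ := one_step K hK g hg R F hne hK0
      refine ⟨g', R', hg', by omega, ?_⟩
      calc 32 ^ (m+1) * (LargeSet K g' R' F).card
          = 32 ^ m * (32 * (LargeSet K g' R' F).card) := by ring
        _ ≤ 32 ^ m * (31 * (LargeSet K g R F).card) := Nat.mul_le_mul_left _ hc'
        _ = 31 * (32 ^ m * (LargeSet K g R F).card) := by ring
        _ ≤ 31 * (31 ^ m * (LargeSet K Fin.castSucc ∅ F).card) := Nat.mul_le_mul_left _ hc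
        _ = _ := by ring

end Haken

/-! ## From QU-resolution to the monotone setting -/

section QBF

/-- The variable is one of the `X_n`. -/
def IsX (n : ℕ) (x : ℕ) : Prop := ∃ (i : Fin (n+1)) (j : Fin n), x = xv (i+1) (j+1)

/-- Monotone version of a clause over `X_n`. -/
noncomputable def plusC (n : ℕ) (C : Clause) : Finset (Fin (n+1) × Fin n) :=
  open Classical in
  Finset.univ.filter fun p => Lit.pos (xv (p.1+1) (p.2+1)) ∈ C ∨
    ∃ i' : Fin (n+1), i' ≠ p.1 ∧ Lit.neg (xv (i'+1) (p.2+1)) ∈ C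

lemma xv_inj {a b c d : ℕ} : xv a b = xv c d ↔ a = c ∧ b = d := by
  simp [xv, Nat.pair_eq_pair]

lemma yv_inj {a b c d : ℕ} : yv a b = yv c d ↔ a = c ∧ b = d := by
  simp [yv, Nat.pair_eq_pair]

lemma xv_ne_yv {a b c d : ℕ} : xv a b ≠ yv c d := by
  simp [xv, yv, Nat.pair_eq_pair]

lemma xv_ne_zv {a b c d e : ℕ} : xv a b ≠ zv c d e := by
  simp [xv, zv, Nat.pair_eq_pair]

lemma yv_ne_zv {a b c d e : ℕ} : yv a b ≠ zv c d e := by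
  simp [yv, zv, Nat.pair_eq_pair]

open Classical in
/-- The assignment given by a critical assignment. -/
noncomputable def valOf {n : ℕ} (g : Fin n → Fin (n+1)) : ℕ → Bool := fun x =>
  decide (∃ j : Fin n, x = xv (g j + 1) (j+1))

lemma valOf_xv {n : ℕ} (g : Fin n → Fin (n+1)) (i : Fin (n+1)) (j : Fin n) :
    valOf g (xv (i+1) (j+1)) = true ↔ g j = i := by
  simp only [valOf, decide_eq_true_eq, xv_inj, Nat.add_right_cancel_iff]
  constructor
  · rintro ⟨j', h1, h2⟩
    obtain rfl := Fin.ext h2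
    exact Fin.ext h1.symm
  · rintro rfl
    exact ⟨j, rfl, rfl⟩

lemma eval_iff {n : ℕ} (g : Fin n → Fin (n+1)) (C : Clause) (hC : ∀ l ∈ C, IsX n l.var) :
    evalClause (valOf g) C ↔ MTrue g (plusC n C) := by
  simp only [evalClause, MTrue, plusC, Finset.mem_filter, Finset.mem_univ, true_and]
  constructor
  · rintro ⟨l, hl, he⟩
    obtain ⟨i, j, hij⟩ := hC l hl
    cases l with
    | pos x =>
      simp only [Lit.var] at hij
      subst hij
      simp only [Lit.eval] at he
      rw [valOf_xv] at he
      subst he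
      exact ⟨j, Or.inl hl⟩
    | neg x =>
      simp only [Lit.var] at hij
      subst hij
      simp only [Lit.eval, Bool.not_eq_true', ← Bool.not_eq_true] at he
      rw [valOf_xv] at he
      exact ⟨j, Or.inr ⟨i, Ne.symm he, hl⟩⟩
  · rintro ⟨j, h | ⟨i', hi', h⟩⟩
    · exact ⟨_, h, by simp only [Lit.eval]; rw [valOf_xv]⟩
    · refine ⟨_, h, ?_⟩
      simp only [Lit.eval, Bool.not_eq_true', ← Bool.not_eq_true]
      rw [valOf_xv]
      exact hi'.symm

lemma eval_res (v : ℕ → Bool) (x : ℕ) (A B : Clause) (hA : evalClause v A) (hB : evalClause v B) :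
    evalClause v ((A.erase (Lit.pos x)) ∪ (B.erase (Lit.neg x))) := by
  obtain ⟨a, ha, hae⟩ := hA
  obtain ⟨b, hb, hbe⟩ := hB
  by_cases h1 : a = Lit.pos x
  · by_cases h2 : b = Lit.neg x
    · subst h1 h2
      simp_all [Lit.eval]
    · exact ⟨b, by simp [h2, hb], hbe⟩
  · exact ⟨a, by simp [h1, ha], hae⟩

/-- `Z` is set according to the Skolem strategy. -/
def Cons (n : ℕ) (v : ℕ → Bool) : Prop :=
  (∀ i < n+1, (v (zv (i+1) 0 0) = true ↔ ∃ j < n, v (yv (i+1) (j+1)) = true)) ∧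
  (∀ i₁ i₂ j, (v (zv (i₁+1) (i₂+1) (j+1)) = true ↔
    ¬ (v (yv (i₁+1) (j+1)) = true ∧ v (yv (i₂+1) (j+1)) = true)))

lemma exists_cons (n : ℕ) (u : ℕ → Bool) :
    ∃ v, Cons n v ∧ ∀ i j, v (yv i j) = u (yv i j) := by
  classical
  refine ⟨fun x => if x.unpair.1 = 2 then
    (if x.unpair.2.unpair.2 = 0 then decide (∃ j < n, u (yv x.unpair.2.unpair.1 (j+1)) = true)
     else decide (¬ (u (yv x.unpair.2.unpair.1 x.unpair.2.unpair.2.unpair.2) = true ∧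
       u (yv x.unpair.2.unpair.2.unpair.1 x.unpair.2.unpair.2.unpair.2) = true)))
    else u x, ⟨?_, ?_⟩, ?_⟩
  · intro i hi
    have : Nat.pair 0 0 = 0 := by decide
    simp [zv, yv, this]
  · intro i₁ i₂ j
    have : Nat.pair (i₂+1) (j+1) ≠ 0 := by
      intro h
      have := Nat.left_le_pair (i₂+1) (j+1)
      omega
    simp [zv, yv, this]
    grind
  · intro i j
    simp [yv]

lemma mem_Zlist (n x : ℕ) : x ∈ Zlist n ↔ (∃ i < n+1, x = zv (i+1) 0 0) ∨
    ∃ j < n, ∃ i₁ < n+1, ∃ i₂ < n+1, i₁ < i₂ ∧ x = zv (i₁+1) (i₂+1) (j+1) := by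
  simp only [Zlist, List.mem_append, List.mem_map, List.mem_range, List.mem_flatMap,
    List.mem_filterMap, Option.ite_none_right_eq_some, Option.some.injEq]
  grind

lemma mem_Ylist (n x : ℕ) : x ∈ Ylist n ↔ ∃ i < n+1, ∃ j < n, x = yv (i+1) (j+1) := by
  simp only [Ylist, List.mem_map, List.mem_range, List.mem_flatMap]
  grind

lemma mem_Xlist (n x : ℕ) : x ∈ Xlist n ↔ ∃ i < n+1, ∃ j < n, x = xv (i+1) (j+1) := by
  simp only [Xlist, List.mem_map, List.mem_range, List.mem_flatMap]
  grind

lemma tphp_cases (n : ℕ) (C : Clause) (hC : C ∈ TPHPcls n) :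
    C = ((Zlist n).map Lit.neg).toFinset ∨
    (∃ i < n+1, ∃ j < n, C = {Lit.pos (zv (i+1) 0 0), Lit.neg (yv (i+1) (j+1))}) ∨
    (∃ j < n, ∃ i₁ < n+1, ∃ i₂ < n+1, i₁ < i₂ ∧
      (C = {Lit.pos (zv (i₁+1) (i₂+1) (j+1)), Lit.pos (yv (i₁+1) (j+1))} ∨
       C = {Lit.pos (zv (i₁+1) (i₂+1) (j+1)), Lit.pos (yv (i₂+1) (j+1))})) := by
  simp only [TPHPcls, Finset.mem_union, Finset.mem_singleton, List.mem_toFinset,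
    List.mem_flatMap, List.mem_range, List.mem_map] at hC
  rcases hC with (h | ⟨i, hi, j, hj, rfl⟩) | ⟨j, hj, i₁, h1, i₂, h2, h⟩
  · exact Or.inl h
  · exact Or.inr (Or.inl ⟨i, hi, j, hj, rfl⟩)
  · split_ifs at h with hlt
    · simp only [List.mem_cons, List.not_mem_nil, or_false] at h
      exact Or.inr (Or.inr ⟨j, hj, i₁, h1, i₂, h2, hlt, h⟩)
    · simp at h

lemma php_cases (n : ℕ) (C : Clause) (hC : C ∈ PHPcls n) :
    (∃ i < n+1, C = ((List.range n).map fun j => Lit.pos (xv (i+1) (j+1))).toFinset) ∨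
    (∃ j < n, ∃ i₁ < n+1, ∃ i₂ < n+1, i₁ < i₂ ∧
      C = {Lit.neg (xv (i₁+1) (j+1)), Lit.neg (xv (i₂+1) (j+1))}) := by
  simp only [PHPcls, Finset.mem_union, List.mem_toFinset, List.mem_filterMap,
    List.mem_flatMap, List.mem_range, List.mem_map, Option.ite_none_right_eq_some,
    Option.some.injEq] at hC
  rcases hC with ⟨i, hi, rfl⟩ | ⟨j, hj, i₁, h1, i₂, h2, hlt, rfl⟩
  · exact Or.inl ⟨i, hi, rfl⟩
  · exact Or.inr ⟨j, hj, i₁, h1, i₂, h2, hlt, rfl⟩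

lemma tphp_sound (n : ℕ) (C : Clause) (hC : C ∈ TPHPcls n) (v : ℕ → Bool) (hv : Cons n v) :
    evalClause v C := by
  obtain ⟨hv1, hv2⟩ := hv
  rcases tphp_cases n C hC with rfl | ⟨i, hi, j, hj, rfl⟩ | ⟨j, hj, i₁, h1, i₂, h2, hlt, h⟩
  · by_contra hcon
    have hz : ∀ x ∈ Zlist n, v x = true := by
      intro x hx
      by_contra hx'
      exact hcon ⟨Lit.neg x, by simpa using hx, by simpa [Lit.eval] using hx'⟩
    have hf : ∀ i : Fin (n+1), ∃ j : Fin n, v (yv (i+1) (j+1)) = true := by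
      intro i
      obtain ⟨j, hj, h⟩ := (hv1 i i.2).1 (hz _ ((mem_Zlist n _).2 (Or.inl ⟨i, i.2, rfl⟩)))
      exact ⟨⟨j, hj⟩, h⟩
    choose f hf using hf
    have hinj : Function.Injective f := by
      have hlt : ∀ a b : Fin (n+1), a < b → f a ≠ f b := by
        intro a b hab heq
        have := (hv2 a b (f a)).1 (hz _ ((mem_Zlist n _).2
          (Or.inr ⟨f a, (f a).2, a, a.2, b, b.2, hab, rfl⟩)))
        exact this ⟨hf a, by rw [heq]; exact hf b⟩
      intro a b hab
      rcases lt_trichotomy a b with h | h | h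
      · exact absurd hab (hlt a b h)
      · exact h
      · exact absurd hab.symm (hlt b a h)
    have := Fintype.card_le_of_injective f hinj
    simp at this
  · by_cases hy : v (yv (i+1) (j+1)) = true
    · exact ⟨Lit.pos (zv (i+1) 0 0), by simp, (hv1 i hi).2 ⟨j, hj, hy⟩⟩
    · exact ⟨Lit.neg (yv (i+1) (j+1)), by simp, by simpa [Lit.eval] using hy⟩
  · rcases h with rfl | rfl
    · by_cases hy : v (yv (i₁+1) (j+1)) = true
      · exact ⟨Lit.pos (yv (i₁+1) (j+1)), by simp, by simpa [Lit.eval] using hy⟩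
      · exact ⟨Lit.pos (zv (i₁+1) (i₂+1) (j+1)), by simp, (hv2 i₁ i₂ j).2 fun h => hy h.1⟩
    · by_cases hy : v (yv (i₂+1) (j+1)) = true
      · exact ⟨Lit.pos (yv (i₂+1) (j+1)), by simp, by simpa [Lit.eval] using hy⟩
      · exact ⟨Lit.pos (zv (i₁+1) (i₂+1) (j+1)), by simp, (hv2 i₁ i₂ j).2 fun h => hy h.2⟩

lemma tphp_vars (n : ℕ) (C : Clause) (hC : C ∈ TPHPcls n) :
    ∀ l ∈ C, l.var ∈ Ylist n ∨ l.var ∈ Zlist n := by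
  intro l hl
  rcases tphp_cases n C hC with rfl | ⟨i, hi, j, hj, rfl⟩ | ⟨j, hj, i₁, h1, i₂, h2, hlt, h⟩
  · simp only [List.mem_toFinset, List.mem_map] at hl
    obtain ⟨x, hx, rfl⟩ := hl
    exact Or.inr hx
  · simp only [Finset.mem_insert, Finset.mem_singleton] at hl
    rcases hl with rfl | rfl
    · exact Or.inr ((mem_Zlist n _).2 (Or.inl ⟨i, hi, rfl⟩))
    · exact Or.inl ((mem_Ylist n _).2 ⟨i, hi, j, hj, rfl⟩)
  · rcases h with rfl | rfl <;>
    · simp only [Finset.mem_insert, Finset.mem_singleton] at hl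
      rcases hl with rfl | rfl
      · exact Or.inr ((mem_Zlist n _).2 (Or.inr ⟨j, hj, i₁, h1, i₂, h2, hlt, rfl⟩))
      · exact Or.inl ((mem_Ylist n _).2 ⟨_, by assumption, j, hj, rfl⟩)

lemma php_vars (n : ℕ) (C : Clause) (hC : C ∈ PHPcls n) : ∀ l ∈ C, IsX n l.var := by
  intro l hl
  rcases php_cases n C hC with ⟨i, hi, rfl⟩ | ⟨j, hj, i₁, h1, i₂, h2, hlt, rfl⟩
  · simp only [List.mem_toFinset, List.mem_map, List.mem_range] at hl
    obtain ⟨j, hj, rfl⟩ := hl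
    exact ⟨⟨i, hi⟩, ⟨j, hj⟩, rfl⟩
  · simp only [Finset.mem_insert, Finset.mem_singleton] at hl
    rcases hl with rfl | rfl
    · exact ⟨⟨i₁, h1⟩, ⟨j, hj⟩, rfl⟩
    · exact ⟨⟨i₂, h2⟩, ⟨j, hj⟩, rfl⟩

lemma php_crit (n : ℕ) (C : Clause) (hC : C ∈ PHPcls n)
    (g₀ : Fin n → Fin (n+1)) (R : Finset (Fin n)) : (Crit g₀ R (plusC n C)).card ≤ 1 := by
  have hX := php_vars n C hC
  rcases php_cases n C hC with ⟨i, hi, rfl⟩ | ⟨j, hj, i₁, h1, i₂, h2, hlt, rfl⟩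
  · apply crit_ax g₀ R _ ⟨i, hi⟩
    rintro g hg ⟨j, hgj⟩
    rw [← eval_iff g _ hX]
    refine ⟨Lit.pos (xv (i+1) (j+1)), ?_, ?_⟩
    · simp only [List.mem_toFinset, List.mem_map, List.mem_range]
      exact ⟨j, j.2, rfl⟩
    · exact (valOf_xv g ⟨i, hi⟩ j).2 hgj
  · apply crit_ax g₀ R _ 0
    rintro g hg -
    rw [← eval_iff g _ hX]
    by_cases hgj : g ⟨j, hj⟩ = ⟨i₁, h1⟩
    · refine ⟨Lit.neg (xv (i₂+1) (j+1)), by simp, ?_⟩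
      simp only [Lit.eval, Bool.not_eq_true', ← Bool.not_eq_true]
      rw [valOf_xv g ⟨i₂, h2⟩ ⟨j, hj⟩, hgj]
      simp only [Fin.mk.injEq]
      omega
    · refine ⟨Lit.neg (xv (i₁+1) (j+1)), by simp, ?_⟩
      simp only [Lit.eval, Bool.not_eq_true', ← Bool.not_eq_true]
      rw [valOf_xv g ⟨i₁, h1⟩ ⟨j, hj⟩]
      exact hgj

/-- Invariant of clauses derived from the `TPHP'` part. -/
def YZInv (n : ℕ) (C : Clause) : Prop :=
  ¬ C.Taut ∧ (∀ l ∈ C, l.var ∈ Ylist n ∨ l.var ∈ Zlist n) ∧ ∀ v, Cons n v → evalClause v C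

lemma yz_has_z (n : ℕ) (C : Clause) (hC : YZInv n C) : ∃ l ∈ C, l.var ∈ Zlist n := by
  classical
  obtain ⟨hT, hV, hE⟩ := hC
  by_contra! hno
  obtain ⟨v, hv, hvu⟩ := exists_cons n (fun x => decide (Lit.neg x ∈ C))
  obtain ⟨l, hl, he⟩ := hE v hv
  have hy := (hV l hl).resolve_right (hno l hl)
  obtain ⟨i, hi, j, hj, hij⟩ := (mem_Ylist n _).1 hy
  cases l with
  | pos x =>
    simp only [Lit.var] at hij
    subst hij
    simp only [Lit.eval, hvu, decide_eq_true_eq] at he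
    exact hT ⟨_, hl, he⟩
  | neg x =>
    simp only [Lit.var] at hij
    subst hij
    simp [Lit.eval, hvu, hl] at he

lemma isX_not_yz (n x : ℕ) (hx : IsX n x) : ¬ (x ∈ Ylist n ∨ x ∈ Zlist n) := by
  obtain ⟨i, j, rfl⟩ := hx
  rw [mem_Ylist, mem_Zlist]
  rintro (⟨_, _, _, _, h⟩ | ⟨_, _, h⟩ | ⟨_, _, _, _, _, _, _, h⟩)
  · exact xv_ne_yv h
  · exact xv_ne_zv h
  · exact xv_ne_zv h

lemma res_not_taut (x : ℕ) (A B : Clause) (hA : ¬ A.Taut) (hB : ¬ B.Taut)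
    (hblock : ∀ l ∈ A.erase (Lit.pos x), l.negate ∉ B.erase (Lit.neg x)) :
    ¬ Clause.Taut ((A.erase (Lit.pos x)) ∪ (B.erase (Lit.neg x))) := by
  rintro ⟨y, h1, h2⟩
  rw [Finset.mem_union] at h1 h2
  rcases h1 with h1 | h1 <;> rcases h2 with h2 | h2
  · exact hA ⟨y, Finset.mem_of_mem_erase h1, Finset.mem_of_mem_erase h2⟩
  · exact hblock _ h1 h2
  · exact hblock _ h2 h1
  · exact hB ⟨y, Finset.mem_of_mem_erase h1, Finset.mem_of_mem_erase h2⟩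

lemma inv_all (n t m : ℕ) (ht : 1 ≤ t) (Ψ : PCNF) (hM : Ψ.matrix = phiMatrix n)
    (hU : ∀ x, Ψ.univB x = true → x ∈ Ylist n)
    (hZ : ∀ z ∈ Zlist n, Ψ.existB z = true ∧ ∀ y ∈ Ylist n, ¬ Ψ.lv z < Ψ.lv y)
    (π : List Clause) (hπ : QValid Ψ true π)
    (g₀ : Fin n → Fin (n+1)) (hg₀ : Function.Injective g₀) (R : Finset (Fin n))
    (hR : R.card ≤ m)
    (hL : LargeSet ((t+1) * (n + 1 - m - 2 * t)) g₀ R (π.toFinset.image (plusC n)) = ∅) :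
    ∀ i < π.length, ((∀ l ∈ π[i]!, IsX n l.var) ∧ (Crit g₀ R (plusC n π[i]!)).card ≤ t) ∨
      YZInv n π[i]! := by
  intro i
  induction i using Nat.strong_induction_on with
  | _ i ih =>
  intro hi
  have prevInv : ∀ A ∈ π.take i, ((∀ l ∈ A, IsX n l.var) ∧ (Crit g₀ R (plusC n A)).card ≤ t) ∨
      YZInv n A := by
    intro A hA
    obtain ⟨k, hk, rfl⟩ := List.mem_take_iff_getElem.1 hA
    have hk1 : k < i := by omega
    have hk2 : k < π.length := by omega
    have := ih k hk1 hk2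
    rwa [getElem!_pos π k hk2] at this
  have hmem : π[i]! ∈ π.toFinset := by
    rw [getElem!_pos π i hi]
    simp
  have hstep := hπ i hi
  generalize π[i]! = C at hstep hmem
  cases hstep with
  | ax _ hC hnt =>
    rw [hM, phiMatrix, Finset.mem_union] at hC
    rcases hC with hC | hC
    · exact Or.inr ⟨hnt, tphp_vars n C hC, tphp_sound n C hC⟩
    · exact Or.inl ⟨php_vars n C hC, (php_crit n C hC g₀ R).trans ht⟩
  | res x A B hA hB hxa hxb hpiv hblock =>
    rcases prevInv A hA with ⟨hAX, hAc⟩ | hAY <;> rcases prevInv B hB with ⟨hBX, hBc⟩ | hBY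
    · left
      have hX : ∀ l ∈ (A.erase (Lit.pos x)) ∪ (B.erase (Lit.neg x)), IsX n l.var := by
        intro l hl
        rw [Finset.mem_union] at hl
        rcases hl with hl | hl
        · exact hAX l (Finset.mem_of_mem_erase hl)
        · exact hBX l (Finset.mem_of_mem_erase hl)
      refine ⟨hX, ?_⟩
      have hc := crit_res g₀ R (plusC n A) (plusC n B)
        (plusC n ((A.erase (Lit.pos x)) ∪ (B.erase (Lit.neg x)))) (by
          intro g h1 h2
          rw [← eval_iff g _ hX]
          exact eval_res _ x A B ((eval_iff g _ hAX).2 h1) ((eval_iff g _ hBX).2 h2))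
      by_contra hlt
      have := medium_large g₀ hg₀ R m t hR (π.toFinset.image (plusC n)) _
        (Finset.mem_image_of_mem _ hmem) (by omega) (by omega)
      rw [hL] at this
      simp at this
    · exact absurd (hBY.2.1 _ hxb) (isX_not_yz n x (hAX _ hxa))
    · exact absurd (hAY.2.1 _ hxa) (isX_not_yz n x (hBX _ hxb))
    · right
      refine ⟨res_not_taut x A B hAY.1 hBY.1 hblock, ?_, fun v hv =>
        eval_res v x A B (hAY.2.2 v hv) (hBY.2.2 v hv)⟩
      intro l hl
      rw [Finset.mem_union] at hl
      rcases hl with hl | hl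
      · exact hAY.2.1 l (Finset.mem_of_mem_erase hl)
      · exact hBY.2.1 l (Finset.mem_of_mem_erase hl)
  | fac _ hA => exact prevInv C hA
  | univRed A mm hA hm hu hlv =>
    rcases prevInv A hA with ⟨hAX, hAc⟩ | hAY
    · exact absurd (Or.inl (hU _ hu)) (isX_not_yz n _ (hAX mm hm))
    · exfalso
      obtain ⟨l, hl, hlz⟩ := yz_has_z n A hAY
      have hmY := hU _ hu
      have hne : l ≠ mm := by
        rintro rfl
        rw [mem_Ylist] at hmY
        rw [mem_Zlist] at hlz
        obtain ⟨_, _, _, _, h⟩ := hmY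
        rcases hlz with ⟨_, _, h'⟩ | ⟨_, _, _, _, _, _, _, h'⟩ <;>
        · rw [h] at h'
          exact yv_ne_zv h'
      exact (hZ _ hlz).2 _ hmY (hlv l (Finset.mem_erase.2 ⟨hne, hl⟩) (hZ _ hlz).1)

lemma card_le_qSize (π : List Clause) :
    (π.toFinset.filter fun C => C.Nonempty).card ≤ qSize π := by
  induction π with
  | nil => simp [qSize]
  | cons C π ih =>
    have h1 : qSize (C :: π) = C.card + qSize π := by simp [qSize]
    rw [h1, List.toFinset_cons, Finset.filter_insert]
    split_ifs with h
    · have := Finset.card_pos.2 h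
      have := Finset.card_insert_le C (π.toFinset.filter fun C => C.Nonempty)
      omega
    · omega

lemma main_bound (n : ℕ) (hn : 8 ≤ n) (Ψ : PCNF) (hM : Ψ.matrix = phiMatrix n)
    (hU : ∀ x, Ψ.univB x = true → x ∈ Ylist n)
    (hZ : ∀ z ∈ Zlist n, Ψ.existB z = true ∧ ∀ y ∈ Ylist n, ¬ Ψ.lv z < Ψ.lv y)
    (π : List Clause) (hπ : QRefutation Ψ true π) :
    32 ^ (n/2) ≤ 31 ^ (n/2) * qSize π := by
  obtain ⟨hval, hne, hlast⟩ := hπ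
  obtain ⟨t, htdef⟩ : ∃ t, t = n / 8 := ⟨_, rfl⟩
  obtain ⟨m, hmdef⟩ : ∃ m, m = n / 2 := ⟨_, rfl⟩
  obtain ⟨r, hr⟩ : ∃ r, r = n + 1 - m - 2 * t := ⟨_, rfl⟩
  have ht1 : 1 ≤ t := by omega
  have h8 : n + 1 ≤ 8 * (t+1) := by omega
  have h4 : n ≤ 4 * r := by omega
  have hK : n * (n+1) ≤ 32 * ((t+1) * r) := by nlinarith
  have hK0 : 0 < (t+1) * r := Nat.mul_pos (by omega) (by omega)
  rw [hr] at hK hK0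
  obtain ⟨g, R, hg, hR, hc⟩ := restrict_all _ hK hK0 (π.toFinset.image (plusC n)) m
  have hlarge : (LargeSet ((t+1) * (n + 1 - m - 2 * t)) g R
      (π.toFinset.image (plusC n))).Nonempty := by
    rw [Finset.nonempty_iff_ne_empty]
    intro hL
    have hinv := inv_all n t m ht1 Ψ hM hU hZ π hval g hg R hR hL (π.length - 1)
      (by have := List.length_pos_iff.2 hne; omega)
    have hl : π[π.length - 1]! = ∅ := by
      rw [← hlast, List.getLast!_eq_getElem!]
    rw [hl] at hinv
    rcases hinv with ⟨-, h⟩ | h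
    · have he : plusC n ∅ = ∅ := by simp [plusC]
      rw [he] at h
      have := crit_empty g hg R
      omega
    · obtain ⟨l, hl, -⟩ := yz_has_z n ∅ h
      simp at hl
  have hsmall : (LargeSet ((t+1) * (n + 1 - m - 2 * t)) Fin.castSucc ∅
      (π.toFinset.image (plusC n))).card ≤ qSize π := by
    refine le_trans ?_ (card_le_qSize π)
    refine le_trans (Finset.card_le_card
      (t := (π.toFinset.filter fun C => C.Nonempty).image (plusC n)) ?_) Finset.card_image_le
    intro M hMm
    simp only [LargeSet, Finset.mem_filter, Finset.mem_image] at hMm ⊢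
    obtain ⟨⟨C, hC, rfl⟩, -, hcard⟩ := hMm
    refine ⟨C, ⟨hC, ?_⟩, rfl⟩
    rw [Finset.nonempty_iff_ne_empty]
    rintro rfl
    have he : plusC n ∅ = ∅ := by simp [plusC]
    rw [he] at hcard
    simp [Rest] at hcard
    simp at hK0
    omega
  have hpos := Finset.card_pos.2 hlarge
  rw [← hmdef]
  calc 32 ^ m ≤ 32 ^ m * _ := Nat.le_mul_of_pos_right _ hpos
    _ ≤ _ := hc
    _ ≤ _ := Nat.mul_le_mul_left _ hsmall

end QBF

lemma poly_small (q : Polynomial ℕ) :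
    Filter.Tendsto (fun n : ℕ => ((q.eval n : ℕ) : ℝ) * (31/32 : ℝ) ^ n) Filter.atTop (nhds 0) := by
  induction q using Polynomial.induction_on' with
  | add p q hp hq =>
    have := hp.add hq
    simp only [add_zero] at this
    refine this.congr fun n => ?_
    simp [add_mul]
  | monomial d a =>
    have h := tendsto_pow_const_mul_const_pow_of_abs_lt_one d
      (r := (31/32 : ℝ)) (by rw [abs_of_pos] <;> norm_num)
    have := h.const_mul (a : ℝ)
    simp only [mul_zero] at this
    refine this.congr fun n => ?_
    simp [mul_assoc]

lemma poly_bound (q : Polynomial ℕ) :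
    ∃ N : ℕ, ∀ n, N ≤ n → 31 ^ (n/2) * q.eval n < 32 ^ (n/2) := by
  have h := poly_small (q.comp (2 * Polynomial.X + 1))
  obtain ⟨N, hN⟩ := Filter.eventually_atTop.1 (h.eventually (gt_mem_nhds (zero_lt_one)))
  refine ⟨2 * N, fun n hn => ?_⟩
  have h1 := hN (n/2) (by omega)
  have hmono : q.eval n ≤ q.eval (2 * (n/2) + 1) := by
    rw [Polynomial.eval_eq_sum, Polynomial.eval_eq_sum]
    apply Finset.sum_le_sum
    intro i _
    exact Nat.mul_le_mul_left _ (Nat.pow_le_pow_left (by omega) _)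
  have h2 : (q.comp (2 * Polynomial.X + 1)).eval (n/2) = q.eval (2 * (n/2) + 1) := by
    simp
  rw [h2, div_pow, mul_div_assoc', div_lt_one (by positivity)] at h1
  have h3 : q.eval (2 * (n/2) + 1) * 31 ^ (n/2) < 32 ^ (n/2) := by exact_mod_cast h1
  calc 31 ^ (n/2) * q.eval n ≤ 31 ^ (n/2) * q.eval (2 * (n/2) + 1) := Nat.mul_le_mul_left _ hmono
    _ < _ := by rwa [mul_comm]

lemma Z_not_Y (n x : ℕ) (h : x ∈ Zlist n) : x ∉ Ylist n := by
  rw [mem_Ylist]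
  rw [mem_Zlist] at h
  rintro ⟨_, _, _, _, rfl⟩
  rcases h with ⟨_, _, h'⟩ | ⟨_, _, _, _, _, _, _, h'⟩ <;> exact yv_ne_zv h'

lemma Z_not_X (n x : ℕ) (h : x ∈ Zlist n) : x ∉ Xlist n := by
  rw [mem_Xlist]
  rw [mem_Zlist] at h
  rintro ⟨_, _, _, _, rfl⟩
  rcases h with ⟨_, _, h'⟩ | ⟨_, _, _, _, _, _, _, h'⟩ <;> exact xv_ne_zv h'

lemma Y_not_X (n x : ℕ) (h : x ∈ Ylist n) : x ∉ Xlist n := by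
  rw [mem_Xlist]
  rw [mem_Ylist] at h
  rintro ⟨_, _, _, _, rfl⟩
  rcases h with ⟨_, _, _, _, h'⟩
  exact xv_ne_yv h'

/-- every QU-res refutation of Φ_n and of Ω_n has
superpolynomial size. -/
theorem qures_superpolynomial_on_Phi_Omega :
    ∀ q : Polynomial ℕ, ∃ N : ℕ, ∀ n : ℕ, N ≤ n →
      (∀ π : List Clause, QRefutation (PhiF n) true π → q.eval n < qSize π) ∧
      (∀ π : List Clause, QRefutation (OmegaF n) true π → q.eval n < qSize π) := by
  intro q
  obtain ⟨N, hN⟩ := poly_bound q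
  refine ⟨max N 8, fun n hn => ⟨fun π hπ => ?_, fun π hπ => ?_⟩⟩
  · have hb := hN n (le_trans (le_max_left _ _) hn)
    have := main_bound n (le_trans (le_max_right _ _) hn) (PhiF n) rfl
      (by intro x hx; simpa [PCNF.univB, PhiF] using hx)
      (by
        intro z hz
        refine ⟨by simp [PCNF.existB, PhiF, hz], fun y hy => ?_⟩
        have hzY := Z_not_Y n z hz
        have hzX := Z_not_X n z hz
        have hyX := Y_not_X n y hy
        simp [PCNF.lv, PhiF, List.findIdx_cons, hz, hy, hzY, hzX, hyX]) π hπ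
    exact Nat.lt_of_mul_lt_mul_left (lt_of_lt_of_le hb this)
  · have hb := hN n (le_trans (le_max_left _ _) hn)
    have := main_bound n (le_trans (le_max_right _ _) hn) (OmegaF n) rfl
      (by intro x hx; simpa [PCNF.univB, OmegaF] using hx)
      (by
        intro z hz
        refine ⟨by simp [PCNF.existB, OmegaF, hz], fun y hy => ?_⟩
        have hzY := Z_not_Y n z hz
        simp [PCNF.lv, OmegaF, List.findIdx_cons, hz, hy, hzY]) π hπ
    exact Nat.lt_of_mul_lt_mul_left (lt_of_lt_of_le hb this)
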